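/- arXiv:1403.4517 — 3 statements merged into one kernel-verified Lean document; each statement's English description precedes it below -/
import Mathlib

section
/- Let V_1, …, V_r be nonempty finite subsets of ℝ^n and let v_1, …, v_r ∈ ℝ^ρ be linearly independent. Let C ⊆ ℝ^n × ℝ^ρ be the convex cone generated by the set {(x, v_i) : 1 ≤ i ≤ r, x ∈ V_i}. Then for all nonnegative reals a_1, …, a_r, the fiber of C over a_1 v_1 + ⋯ + a_r v_r is the Minkowski sum of the scaled convex hulls: {x ∈ ℝ^n : (x, a_1 v_1 + ⋯ + a_r v_r) ∈ C} = a_1•conv(V_1) + ⋯ + a_r•conv(V_r). -/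
open Pointwise

/-- The convex cone generated by a set `Q`: all finite nonnegative linear
combinations of elements of `Q` (the empty combination giving `0`). -/
def coneGen {E : Type*} [AddCommMonoid E] [Module ℝ E] (Q : Set E) : Set E :=
  {x | ∃ (k : ℕ) (c : Fin k → ℝ) (g : Fin k → E),
    (∀ i, 0 ≤ c i) ∧ (∀ i, g i ∈ Q) ∧ x = ∑ i, c i • g i}

section ConeGen

variable {E : Type*} [AddCommMonoid E] [Module ℝ E] {Q : Set E}

theorem subset_coneGen : Q ⊆ coneGen Q := fun x hx =>
  ⟨1, fun _ => 1, fun _ => x, fun _ => zero_le_one, fun _ => hx, by simp⟩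

theorem zero_mem_coneGen : (0 : E) ∈ coneGen Q :=
  ⟨0, Fin.elim0, Fin.elim0, fun i => i.elim0, fun i => i.elim0, by simp⟩

theorem add_mem_coneGen {x y : E} (hx : x ∈ coneGen Q) (hy : y ∈ coneGen Q) :
    x + y ∈ coneGen Q := by
  obtain ⟨k, c, g, hc, hg, rfl⟩ := hx
  obtain ⟨l, d, h, hd, hh, rfl⟩ := hy
  refine ⟨k + l, Fin.append c d, Fin.append g h, fun i => ?_, fun i => ?_, ?_⟩
  · induction i using Fin.addCases <;> simp [hc, hd]
  · induction i using Fin.addCases <;> simp [hg, hh]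
  · simp [Fin.sum_univ_add]

theorem smul_mem_coneGen {t : ℝ} (ht : 0 ≤ t) {x : E} (hx : x ∈ coneGen Q) :
    t • x ∈ coneGen Q := by
  obtain ⟨k, c, g, hc, hg, rfl⟩ := hx
  exact ⟨k, fun i => t * c i, g, fun i => mul_nonneg ht (hc i), hg, by
    simp [Finset.smul_sum, mul_smul]⟩

theorem sum_mem_coneGen {ι : Type*} {s : Finset ι} {f : ι → E}
    (hf : ∀ i ∈ s, f i ∈ coneGen Q) : ∑ i ∈ s, f i ∈ coneGen Q :=
  Finset.sum_induction f (· ∈ coneGen Q) (fun _ _ => add_mem_coneGen) zero_mem_coneGen hf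

theorem convex_coneGen : Convex ℝ (coneGen Q) := fun _ hx _ hy _ _ ha hb _ =>
  add_mem_coneGen (smul_mem_coneGen ha hx) (smul_mem_coneGen hb hy)

end ConeGen

/-- A nonnegative combination of points of a nonempty convex set lies in the dilate of the set
by the total weight. -/
theorem Convex.sum_smul_mem_sum_smul {E ι : Type*} [AddCommGroup E] [Module ℝ E] {s : Set E}
    (hs : Convex ℝ s) (hne : s.Nonempty) (t : Finset ι) {c : ι → ℝ} {y : ι → E}
    (hc : ∀ j ∈ t, 0 ≤ c j) (hy : ∀ j ∈ t, y j ∈ s) :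
    ∑ j ∈ t, c j • y j ∈ (∑ j ∈ t, c j) • s := by
  classical
  induction t using Finset.induction_on with
  | empty => simp [Set.zero_smul_set hne]
  | insert j t hj ih =>
    simp only [Finset.forall_mem_insert] at hc hy
    rw [Finset.sum_insert hj, Finset.sum_insert hj,
      hs.add_smul hc.1 (Finset.sum_nonneg hc.2)]
    exact Set.add_mem_add (Set.smul_mem_smul_set hy.1) (ih hc.2 hy.2)

/-- A horizontal slice of a convex set that contains `S` contains the convex hull of `S`. -/
theorem convexHull_prodMk_subset {E F : Type*} [AddCommGroup E] [Module ℝ E] [AddCommGroup F]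
    [Module ℝ F] {S : Set E} {w : F} {K : Set (E × F)} (hK : Convex ℝ K)
    (h : ∀ z ∈ S, (z, w) ∈ K) {z : E} (hz : z ∈ convexHull ℝ S) : (z, w) ∈ K := by
  refine convexHull_min (t := {z | (z, w) ∈ K}) h (fun x hx y hy a b ha hb hab => ?_) hz
  simpa [← add_smul, hab] using hK hx hy ha hb hab

/-- Let `V 1, …, V r` be nonempty finite subsets of `ℝ^n` and let
`v 1, …, v r ∈ ℝ^ρ` be linearly independent.  Let `C` be the convex cone
generated by `{(x, vᵢ) : x ∈ Vᵢ}`.  Then for all nonnegative reals `aᵢ`,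
the fiber of `C` over `a₁ v₁ + ⋯ + aᵣ vᵣ` is the Minkowski sum
`a₁•conv(V₁) + ⋯ + aᵣ•conv(Vᵣ)`. -/
theorem stmt_1 (n ρ r : ℕ)
    (V : Fin r → Finset (Fin n → ℝ)) (hV : ∀ i, (V i).Nonempty)
    (v : Fin r → (Fin ρ → ℝ)) (hv : LinearIndependent ℝ v)
    (a : Fin r → ℝ) (ha : ∀ i, 0 ≤ a i) :
    {x : Fin n → ℝ | (x, ∑ i, a i • v i) ∈
        coneGen {q : (Fin n → ℝ) × (Fin ρ → ℝ) | ∃ i : Fin r, ∃ y ∈ V i, q = (y, v i)}}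
      = ∑ i, a i • convexHull ℝ (V i : Set (Fin n → ℝ)) := by
  classical
  ext x
  rw [Set.mem_ofPred_eq, Set.mem_fintype_sum]
  constructor
  · rintro ⟨k, c, g, hc, hg, hx⟩
    choose f y hy hgy using hg
    obtain rfl : g = fun j => (y j, v (f j)) := funext hgy
    rw [Prod.ext_iff, Prod.fst_sum, Prod.snd_sum] at hx
    obtain ⟨hx₁, hx₂⟩ := hx
    have hweights : ∀ i, a i = ∑ j with f j = i, c j := by
      refine Fintype.linearIndependent_iffₛ.1 hv _ _ (hx₂.trans ?_)
      rw [← Finset.sum_fiberwise Finset.univ f]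
      refine Finset.sum_congr rfl fun i _ => ?_
      rw [Finset.sum_smul]
      refine Finset.sum_congr rfl fun j hj => ?_
      simp [(Finset.mem_filter.1 hj).2]
    refine ⟨fun i => ∑ j with f j = i, c j • y j, fun i => ?_, ?_⟩
    · rw [hweights i]
      refine (convex_convexHull ℝ _).sum_smul_mem_sum_smul
        ((Finset.coe_nonempty.2 (hV i)).convexHull) _ (fun j _ => hc j) fun j hj => ?_
      obtain rfl := (Finset.mem_filter.1 hj).2
      exact subset_convexHull ℝ _ (hy j)
    · exact (Finset.sum_fiberwise Finset.univ f _).trans hx₁.symm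
  · rintro ⟨p, hp, rfl⟩
    choose z hz hzp using fun i => Set.mem_smul_set.1 (hp i)
    have hsum : (∑ i, p i, ∑ i, a i • v i) = ∑ i, a i • (z i, v i) := by
      simp [Prod.ext_iff, Prod.fst_sum, Prod.snd_sum, hzp]
    rw [hsum]
    exact sum_mem_coneGen fun i _ => smul_mem_coneGen (ha i) <|
      convexHull_prodMk_subset convex_coneGen
        (fun y hy => subset_coneGen (by exact ⟨i, y, hy, rfl⟩)) (hz i)
end

section
/- For every finite set S ⊆ ℝ^ρ there exist linearly independent subsets T_1, …, T_k of S such that: (i) cone(S) = cone(T_1) ∪ ⋯ ∪ cone(T_k); (ii) cone(T_i) ∩ cone(T_j) = cone(T_i ∩ T_j) for all i, j; and (iii) every nonzero element of S is a positive scalar multiple of an element of T_1 ∪ ⋯ ∪ T_k. -/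
open Pointwise

section LexModule

variable {A B : Type*} [AddCommGroup A] [PartialOrder A] [Module ℝ A] [PosSMulStrictMono ℝ A]
  [AddCommGroup B] [PartialOrder B] [Module ℝ B] [PosSMulStrictMono ℝ B]

theorem prodLex_posSMulStrictMono : PosSMulStrictMono ℝ (A ×ₗ B) where
  smul_lt_smul_of_pos_left r hr x y hxy := by
    rw [Prod.Lex.lt_iff] at hxy ⊢
    rcases hxy with h | ⟨h₁, h₂⟩
    · exact Or.inl (smul_lt_smul_of_pos_left h hr)
    · exact Or.inr ⟨congrArg (r • ·) h₁, smul_lt_smul_of_pos_left h₂ hr⟩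

theorem piLex_posSMulStrictMono {ι : Type*} [LinearOrder ι] :
    PosSMulStrictMono ℝ (Lex (ι → A)) where
  smul_lt_smul_of_pos_left r hr x y hxy := by
    obtain ⟨i, hlt, hi⟩ := hxy
    exact ⟨i, fun j hj => congrArg (r • ·) (hlt j hj), smul_lt_smul_of_pos_left hi hr⟩

end LexModule

section MinimalRepresentation

variable {ι E Γ : Type*} [Fintype ι] [AddCommGroup E] [Module ℝ E]
  [AddCommGroup Γ] [LinearOrder Γ] [IsOrderedAddMonoid Γ] [Module ℝ Γ] [PosSMulStrictMono ℝ Γ]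
  {φ : (ι → ℝ) →ₗ[ℝ] E} {κ : (ι → ℝ) →ₗ[ℝ] Γ}

/-- `c` is a nonnegative coefficient vector of least cost `κ c` among those with the same image
under `φ`. -/
def IsMinimalRep (φ : (ι → ℝ) →ₗ[ℝ] E) (κ : (ι → ℝ) →ₗ[ℝ] Γ) (c : ι → ℝ) : Prop :=
  0 ≤ c ∧ ∀ d, 0 ≤ d → φ d = φ c → κ c ≤ κ d

theorem exists_pos_smul_le {c a : ι → ℝ} (hc : 0 ≤ c) (ha : ∀ i, c i = 0 → a i = 0) :
    ∃ ε : ℝ, 0 < ε ∧ ε • a ≤ c := by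
  have h : ∀ i, ∀ᶠ ε in nhdsWithin (0 : ℝ) (Set.Ioi 0), ε * a i ≤ c i := by
    intro i
    rcases (hc i).eq_or_lt with h0 | hpos
    · have h0' : c i = 0 := h0.symm
      simp [ha i h0', h0']
    · have ht : Filter.Tendsto (fun ε : ℝ => ε * a i) (nhdsWithin 0 (Set.Ioi 0)) (nhds 0) := by
        have : Filter.Tendsto (fun ε : ℝ => ε * a i) (nhds 0) (nhds (0 * a i)) :=
          (continuous_id.mul continuous_const).tendsto 0
        rw [zero_mul] at this
        exact this.mono_left nhdsWithin_le_nhds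
      exact (ht.eventually (gt_mem_nhds hpos)).mono fun _ => le_of_lt
  obtain ⟨ε, hε, hpos⟩ := ((Filter.eventually_all.2 h).and self_mem_nhdsWithin).exists
  exact ⟨ε, hpos, hε⟩

theorem IsMinimalRep.of_support_subset {c c' : ι → ℝ} (h : IsMinimalRep φ κ c) (hc' : 0 ≤ c')
    (hs : ∀ i, c i = 0 → c' i = 0) : IsMinimalRep φ κ c' := by
  refine ⟨hc', fun d hd hφ => ?_⟩
  by_contra! hlt
  obtain ⟨ε, hε, hle⟩ := exists_pos_smul_le h.1 hs
  have hnn : 0 ≤ c - ε • c' + ε • d :=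
    add_nonneg (sub_nonneg.2 hle) (smul_nonneg hε.le hd)
  have hmin := h.2 _ hnn (by simp [hφ])
  have hκ := smul_lt_smul_of_pos_left hlt hε
  simp only [map_add, map_sub, map_smul] at hmin
  have : κ c - ε • κ c' + ε • κ d < κ c - ε • κ c' + ε • κ c' := by gcongr
  rw [sub_add_cancel] at this
  exact absurd hmin this.not_ge

omit [Fintype ι] [IsOrderedAddMonoid Γ] [PosSMulStrictMono ℝ Γ] in
theorem IsMinimalRep.eq {c d : ι → ℝ} (hκ : Function.Injective κ) (hc : IsMinimalRep φ κ c)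
    (hd : IsMinimalRep φ κ d) (h : φ c = φ d) : c = d :=
  hκ ((hc.2 d hd.1 h.symm).antisymm (hd.2 c hc.1 h))

theorem IsMinimalRep.eq_zero_of_map_eq_zero {c a : ι → ℝ} (hκ : Function.Injective κ)
    (hc : IsMinimalRep φ κ c) (hs : ∀ i, c i = 0 → a i = 0) (ha : φ a = 0) : a = 0 := by
  obtain ⟨ε, hε, hle⟩ := exists_pos_smul_le hc.1 hs
  have hmin : IsMinimalRep φ κ (c - ε • a) :=
    hc.of_support_subset (sub_nonneg.2 hle) fun i hi => by simp [hi, hs i hi]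
  have := hc.eq hκ hmin (by simp [ha])
  have h0 : ε • a = 0 := sub_eq_self.1 this.symm
  exact (smul_eq_zero.1 h0).resolve_left hε.ne'

/-- Moving along a kernel vector with a negative coordinate until some coordinate vanishes. -/
theorem exists_add_smul_support_ssubset {d a : ι → ℝ} (hd : 0 ≤ d) (hs : ∀ i, d i = 0 → a i = 0)
    {i : ι} (hi : a i < 0) :
    ∃ t : ℝ, 0 ≤ t ∧ 0 ≤ d + t • a ∧
      Function.support (d + t • a) ⊂ Function.support d := by
  classical
  obtain ⟨j, hj, hmin⟩ := Finset.exists_min_image (Finset.univ.filter fun i => a i < 0)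
    (fun i => d i / -a i) ⟨i, by simpa using hi⟩
  have hj' : a j < 0 := by simpa using hj
  refine ⟨d j / -a j, div_nonneg (hd j) (by linarith), fun k => ?_, ?_⟩
  · have hdk : 0 ≤ d k := hd k
    have ht : 0 ≤ d j / -a j := div_nonneg (hd j) (by linarith)
    simp only [Pi.zero_apply, Pi.add_apply, Pi.smul_apply, smul_eq_mul]
    rcases lt_or_ge (a k) 0 with hk | hk
    · have := (le_div_iff₀ (by linarith : 0 < -a k)).1 (hmin k (by simpa using hk))
      linarith
    · positivity
  · refine (Set.ssubset_iff_of_subset fun k hk hk0 => ?_).2 ⟨j, fun h0 => ?_, fun h => h ?_⟩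
    · exact hk (by simp [hk0, hs k hk0])
    · exact hj'.ne (hs j h0)
    · simp only [Pi.add_apply, Pi.smul_apply, smul_eq_mul]
      have hne := hj'.ne
      field_simp
      ring

theorem exists_le_of_independent_support (hpos : ∀ a, 0 ≤ a → a ≠ 0 → 0 < κ a) (d : ι → ℝ)
    (hd : 0 ≤ d) :
    ∃ c, 0 ≤ c ∧ φ c = φ d ∧ κ c ≤ κ d ∧ ∀ a, (∀ i, c i = 0 → a i = 0) → φ a = 0 → a = 0 := by
  induction hn : (Function.support d).ncard using Nat.strong_induction_on generalizing d with
  | _ n ih =>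
    by_cases hind : ∀ a, (∀ i, d i = 0 → a i = 0) → φ a = 0 → a = 0
    · exact ⟨d, hd, rfl, le_rfl, hind⟩
    push Not at hind
    obtain ⟨a, hs, ha, hne, hκa⟩ : ∃ a : ι → ℝ, (∀ i, d i = 0 → a i = 0) ∧ φ a = 0 ∧ a ≠ 0 ∧
        κ a ≤ 0 := by
      obtain ⟨a, hs, ha, hne⟩ := hind
      rcases le_total (κ a) 0 with h | h
      · exact ⟨a, hs, ha, hne, h⟩
      · exact ⟨-a, fun i hi => by simp [hs i hi], by simp [ha], neg_ne_zero.2 hne, by simpa using h⟩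
    obtain ⟨i, hi⟩ : ∃ i, a i < 0 := by
      by_contra! h
      exact (hpos a h hne).not_ge hκa
    obtain ⟨t, ht, hnn, hss⟩ := exists_add_smul_support_ssubset hd hs hi
    obtain ⟨c, hc, hφ, hκ, hindc⟩ := ih _ (hn ▸ Set.ncard_lt_ncard hss) _ hnn rfl
    refine ⟨c, hc, by simpa [ha] using hφ, hκ.trans ?_, hindc⟩
    simpa using smul_nonpos_of_nonneg_of_nonpos ht hκa

theorem exists_isMinimalRep (hpos : ∀ a, 0 ≤ a → a ≠ 0 → 0 < κ a) (d : ι → ℝ) (hd : 0 ≤ d) :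
    ∃ c, IsMinimalRep φ κ c ∧ φ c = φ d := by
  let P : Set (ι → ℝ) :=
    {c | 0 ≤ c ∧ φ c = φ d ∧ ∀ a, (∀ i, c i = 0 → a i = 0) → φ a = 0 → a = 0}
  have hfin : P.Finite := by
    refine Set.Finite.of_injOn (f := Function.support) (t := Set.univ) (fun _ _ => trivial) ?_
      Set.finite_univ
    intro c hc c' hc' hsupp
    refine sub_eq_zero.1 (hc.2.2 (c - c') (fun i hi => ?_)
      (by rw [map_sub, hc.2.1, hc'.2.1, sub_self]))
    have : c' i = 0 := by
      by_contra h
      exact (hsupp ▸ (show i ∈ Function.support c' from h) : i ∈ Function.support c) hi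
    simp [hi, this]
  obtain ⟨c₀, h₀, hφ₀, -, hind₀⟩ := exists_le_of_independent_support (φ := φ) hpos d hd
  obtain ⟨c, hc, hmin⟩ := Set.exists_min_image P κ hfin ⟨c₀, h₀, hφ₀, hind₀⟩
  refine ⟨c, ⟨hc.1, fun e he hφe => ?_⟩, hc.2.1⟩
  obtain ⟨c', h', hφ', hκ', hind'⟩ := exists_le_of_independent_support (φ := φ) hpos e he
  exact (hmin c' ⟨h', by rw [hφ', hφe, hc.2.1], hind'⟩).trans hκ'

end MinimalRepresentation

section LexCost

variable {ι : Type*} [Fintype ι] [LinearOrder ι]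

/-- The weight `w`, with ties broken lexicographically by coordinates. -/
def lexCost (w : ι → ℝ) : (ι → ℝ) →ₗ[ℝ] ℝ ×ₗ Lex (ι → ℝ) where
  toFun a := toLex (∑ i, a i * w i, toLex a)
  map_add' a b := by
    simp only [Pi.add_apply, add_mul, Finset.sum_add_distrib]
    rfl
  map_smul' r a := by
    simp only [Pi.smul_apply, smul_eq_mul, mul_assoc, ← Finset.mul_sum]
    rfl

omit [LinearOrder ι] in
theorem lexCost_injective (w : ι → ℝ) : Function.Injective (lexCost w) := fun _ _ h =>
  congrArg (fun p : ℝ ×ₗ Lex (ι → ℝ) => ofLex (ofLex p).2) h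

theorem sum_le_of_lexCost_le {w a b : ι → ℝ} (h : lexCost w a ≤ lexCost w b) :
    ∑ i, a i * w i ≤ ∑ i, b i * w i :=
  Prod.Lex.monotone_fst _ _ h

theorem lexCost_pos {w : ι → ℝ} (hw : ∀ i, 0 < w i) {a : ι → ℝ} (ha : 0 ≤ a) (hne : a ≠ 0) :
    0 < lexCost w a := by
  rw [Prod.Lex.lt_iff]
  refine Or.inl ?_
  obtain ⟨i, hi⟩ := Function.ne_iff.1 hne
  exact Finset.sum_pos' (fun j _ => mul_nonneg (ha j) (hw j).le)
    ⟨i, Finset.mem_univ i, mul_pos ((ha i).lt_of_ne (Ne.symm hi)) (hw i)⟩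

end LexCost

theorem mem_coneGen_image_iff {ι E : Type*} [Fintype ι] [AddCommGroup E] [Module ℝ E]
    (v : ι → E) (T : Finset ι) (x : E) :
    x ∈ coneGen (v '' T) ↔
      ∃ c : ι → ℝ, 0 ≤ c ∧ (∀ i ∉ T, c i = 0) ∧ Fintype.linearCombination ℝ v c = x := by
  classical
  constructor
  · rintro ⟨k, c, g, hc, hg, rfl⟩
    choose f hfT hf using hg
    refine ⟨∑ j, c j • Pi.single (f j) 1, Finset.sum_nonneg fun j _ => smul_nonneg (hc j) ?_,
      fun i hi => ?_, ?_⟩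
    · exact Pi.single_nonneg.2 zero_le_one
    · rw [Finset.sum_apply]
      refine Finset.sum_eq_zero fun j _ => ?_
      have : i ≠ f j := fun h => hi (h ▸ hfT j)
      simp [this]
    · simp [map_sum, Fintype.linearCombination_apply_single, hf]
  · rintro ⟨c, hc, hT, rfl⟩
    refine ⟨T.card, fun j => c (T.equivFin.symm j), fun j => v (T.equivFin.symm j),
      fun j => hc _, fun j => ⟨_, (T.equivFin.symm j).2, rfl⟩, ?_⟩
    rw [Equiv.sum_comp T.equivFin.symm (fun i : T => c i • v i), Finset.sum_coe_sort T
      (fun i => c i • v i), Fintype.linearCombination_apply]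
    exact (Finset.sum_subset (Finset.subset_univ T) fun i _ hi => by simp [hT i hi]).symm

/-- Every nonnegative combination of `u` not exceeding the norm of its value is supported on the
ray of that value. -/
theorem sameRay_of_sum_mul_norm_le {ι F : Type*} [Fintype ι] [NormedAddCommGroup F]
    [InnerProductSpace ℝ F] {u : ι → F} {c : ι → ℝ} (hc : 0 ≤ c) {s : F}
    (hs : ∑ i, c i • u i = s) (hle : ∑ i, c i * ‖u i‖ ≤ ‖s‖) {i : ι} (hi : c i ≠ 0) :
    ‖u i‖ • s = ‖s‖ • u i := by
  rw [← inner_eq_norm_mul_iff_real]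
  have hterm : ∀ j ∈ Finset.univ, c j * inner ℝ s (u j) ≤ c j * (‖s‖ * ‖u j‖) := fun j _ =>
    mul_le_mul_of_nonneg_left (real_inner_le_norm _ _) (hc j)
  have hsum : ∑ j, c j * inner ℝ s (u j) = ‖s‖ * ‖s‖ := by
    rw [← real_inner_self_eq_norm_mul_norm]
    conv_rhs => rw [← hs, inner_sum, hs]
    simp [inner_smul_right]
  have hsum' : ∑ j, c j * (‖s‖ * ‖u j‖) ≤ ‖s‖ * ‖s‖ := by
    calc ∑ j, c j * (‖s‖ * ‖u j‖) = ‖s‖ * ∑ j, c j * ‖u j‖ := by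
          rw [Finset.mul_sum]
          exact Finset.sum_congr rfl fun j _ => by ring
      _ ≤ _ := mul_le_mul_of_nonneg_left hle (norm_nonneg s)
  have heq := (Finset.sum_eq_sum_iff_of_le hterm).1
    ((Finset.sum_le_sum hterm).antisymm (hsum'.trans hsum.ge)) i (Finset.mem_univ i)
  exact mul_left_cancel₀ hi heq


/-- The supports of the minimal representations, for the cost given by the Euclidean norms, form a
triangulation of the cone spanned by a finite family that uses every ray of the family. -/
theorem exists_coneGen_triangulation (ρ n : ℕ) (v : Fin n → Fin ρ → ℝ) :
    ∃ 𝒯 : Finset (Finset (Fin n)),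
      (∀ T ∈ 𝒯, LinearIndepOn ℝ v (T : Set (Fin n))) ∧
      (∀ x ∈ coneGen (Set.range v), ∃ T ∈ 𝒯, x ∈ coneGen (v '' T)) ∧
      (∀ T ∈ 𝒯, ∀ T' ∈ 𝒯, coneGen (v '' T) ∩ coneGen (v '' T') ⊆
        coneGen (v '' (T ∩ T' : Finset (Fin n)))) ∧
      (∀ i, v i ≠ 0 → ∃ T ∈ 𝒯, ∃ j ∈ T, ∃ c : ℝ, 0 < c ∧ v i = c • v j) := by
  classical
  have : PosSMulStrictMono ℝ (Lex (Fin n → ℝ)) := piLex_posSMulStrictMono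
  have : PosSMulStrictMono ℝ (ℝ ×ₗ Lex (Fin n → ℝ)) := prodLex_posSMulStrictMono
  let u : Fin n → EuclideanSpace ℝ (Fin ρ) := fun i => WithLp.toLp 2 (v i)
  have hu : ∀ i, u i = 0 ↔ v i = 0 := fun i => WithLp.toLp_eq_zero 2
  let w : Fin n → ℝ := fun i => if v i = 0 then 1 else ‖u i‖
  have hw : ∀ i, 0 < w i := by
    intro i
    by_cases h : v i = 0
    · simp [w, h]
    · simpa [w, h] using (hu i).not.2 h
  let φ := Fintype.linearCombination ℝ v
  have hinj := lexCost_injective w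
  have hex := exists_isMinimalRep (φ := φ) (κ := lexCost w) fun a => lexCost_pos hw
  let supp : (Fin n → ℝ) → Finset (Fin n) := fun c => Finset.univ.filter (c · ≠ 0)
  refine ⟨Finset.univ.filter fun T => ∃ c, IsMinimalRep φ (lexCost w) c ∧ T = supp c,
    ?_, ?_, ?_, ?_⟩
  · intro T hT
    obtain ⟨c, hc, rfl⟩ := (Finset.mem_filter.1 hT).2
    rw [linearIndepOn_finset_iff]
    intro f hf i hi
    have h0 := hc.eq_zero_of_map_eq_zero (a := fun i => if i ∈ supp c then f i else 0) hinj
      (fun i hi => by simp [supp, hi])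
      (by simpa [φ, Fintype.linearCombination_apply, ite_smul, Finset.sum_ite_mem] using hf)
    simpa [hi] using congrFun h0 i
  · intro x hx
    rw [← Set.image_univ, ← Finset.coe_univ, mem_coneGen_image_iff] at hx
    obtain ⟨d, hd, -, rfl⟩ := hx
    obtain ⟨c, hc, hφ⟩ := hex d hd
    exact ⟨supp c, by simpa using ⟨c, hc, rfl⟩,
      (mem_coneGen_image_iff _ _ _).2 ⟨c, hc.1, by simp [supp], hφ⟩⟩
  · rintro T hT T' hT' x ⟨hx, hx'⟩
    obtain ⟨c, hc, rfl⟩ := (Finset.mem_filter.1 hT).2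
    obtain ⟨c', hc', rfl⟩ := (Finset.mem_filter.1 hT').2
    obtain ⟨d, hd, hds, rfl⟩ := (mem_coneGen_image_iff _ _ _).1 hx
    obtain ⟨d', hd', hds', hφ⟩ := (mem_coneGen_image_iff _ _ _).1 hx'
    have hm := hc.of_support_subset hd fun i hi => hds i (by simpa [supp] using hi)
    have hm' := hc'.of_support_subset hd' fun i hi => hds' i (by simpa [supp] using hi)
    obtain rfl : d' = d := hm'.eq hinj hm hφ
    refine (mem_coneGen_image_iff _ _ _).2 ⟨d', hd, fun i hi => ?_, rfl⟩
    by_cases h : i ∈ supp c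
    · exact hds' i fun h' => hi (Finset.mem_inter.2 ⟨h, h'⟩)
    · exact hds i h
  · intro i hi
    obtain ⟨c, hc, hφ⟩ := hex (Pi.single i 1) (Pi.single_nonneg.2 zero_le_one)
    have hcv : ∑ j, c j • v j = v i := by
      simpa [φ, Fintype.linearCombination_apply] using hφ
    have hcu : ∑ j, c j • u j = u i := by
      simp only [u, ← hcv, WithLp.toLp_sum, WithLp.toLp_smul]
    have hle : ∑ j, c j * ‖u j‖ ≤ ‖u i‖ := by
      have h := sum_le_of_lexCost_le (hc.2 _ (Pi.single_nonneg.2 zero_le_one) hφ.symm)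
      have hi' : w i = ‖u i‖ := if_neg hi
      rw [← hi']
      refine (Finset.sum_le_sum fun j _ => mul_le_mul_of_nonneg_left ?_ (hc.1 j)).trans
        (h.trans_eq (by simp [Pi.single_apply]))
      by_cases hj : v j = 0
      · simp [w, hj, (hu j).2 hj]
      · simp [w, hj]
    obtain ⟨j, hj, hvj⟩ : ∃ j, c j ≠ 0 ∧ v j ≠ 0 := by
      by_contra! h
      refine hi (hcv ▸ Finset.sum_eq_zero fun j _ => ?_)
      by_cases hj : c j = 0
      · simp [hj]
      · simp [h j hj]
    have hray := sameRay_of_sum_mul_norm_le hc.1 hcu hle hj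
    have hni : 0 < ‖u i‖ := norm_pos_iff.2 ((hu i).not.2 hi)
    have hnj : 0 < ‖u j‖ := norm_pos_iff.2 ((hu j).not.2 hvj)
    refine ⟨supp c, by simpa using ⟨c, hc, rfl⟩, j, by simpa [supp] using hj, ‖u j‖⁻¹ * ‖u i‖,
      by positivity, ?_⟩
    have hray' : ‖u j‖ • v i = ‖u i‖ • v j := congrArg WithLp.ofLp hray
    rw [mul_smul, ← hray', inv_smul_smul₀ hnj.ne']

theorem coneGen_mono {E : Type*} [AddCommMonoid E] [Module ℝ E] {Q R : Set E} (h : Q ⊆ R) :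
    coneGen Q ⊆ coneGen R := fun _ ⟨k, c, g, hc, hg, hx⟩ => ⟨k, c, g, hc, fun i => h (hg i), hx⟩

/-- Existence of a Minkowski chamber decomposition: for every finite set
`S ⊆ ℝ^ρ` there are linearly independent subsets `T 1, …, T k` of `S` such that
(i) `cone(S) = cone(T 1) ∪ ⋯ ∪ cone(T k)`, (ii) `cone(Tᵢ) ∩ cone(Tⱼ) = cone(Tᵢ ∩ Tⱼ)`
for all `i, j`, and (iii) every nonzero element of `S` is a positive multiple of an
element of `T 1 ∪ ⋯ ∪ T k`. -/
theorem stmt_4 (ρ : ℕ) (S : Finset (Fin ρ → ℝ)) :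
    ∃ (k : ℕ) (T : Fin k → Finset (Fin ρ → ℝ)),
      (∀ j, T j ⊆ S) ∧
      (∀ j, LinearIndependent ℝ (fun x : {x : Fin ρ → ℝ // x ∈ T j} => (x : Fin ρ → ℝ))) ∧
      (coneGen (S : Set (Fin ρ → ℝ)) = ⋃ j, coneGen (T j : Set (Fin ρ → ℝ))) ∧
      (∀ i j, coneGen (T i : Set (Fin ρ → ℝ)) ∩ coneGen (T j : Set (Fin ρ → ℝ))
          = coneGen ((T i ∩ T j : Finset (Fin ρ → ℝ)) : Set (Fin ρ → ℝ))) ∧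
      (∀ s ∈ S, s ≠ 0 → ∃ j, ∃ t ∈ T j, ∃ c : ℝ, 0 < c ∧ s = c • t) := by
  classical
  let v : Fin S.card → Fin ρ → ℝ := fun i => S.equivFin.symm i
  have hv : Function.Injective v := Subtype.val_injective.comp S.equivFin.symm.injective
  have hrange : Set.range v = S := by
    ext x
    exact ⟨fun ⟨i, hi⟩ => hi ▸ (S.equivFin.symm i).2, fun hx => ⟨S.equivFin ⟨x, hx⟩, by simp [v]⟩⟩
  obtain ⟨𝒯, hind, hcover, hinter, hrays⟩ := exists_coneGen_triangulation ρ S.card v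
  let T : Fin 𝒯.card → Finset (Fin ρ → ℝ) := fun j =>
    (𝒯.equivFin.symm j : Finset (Fin S.card)).image v
  have hT : ∀ j, (T j : Set (Fin ρ → ℝ)) = v '' (𝒯.equivFin.symm j : Finset (Fin S.card)) :=
    fun j => Finset.coe_image
  have hsub : ∀ j, T j ⊆ S := fun j => by
    rw [← Finset.coe_subset, hT, ← hrange]
    exact Set.image_subset_range _ _
  have hsurj : ∀ t ∈ 𝒯, ∃ j, T j = t.image v := fun t ht =>
    ⟨𝒯.equivFin ⟨t, ht⟩, by simp [T]⟩
  refine ⟨𝒯.card, T, hsub, fun j => ?_, ?_, fun i j => ?_, fun s hs hs0 => ?_⟩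
  · have h := (hind _ (𝒯.equivFin.symm j).2).id_image
    rw [← hT] at h
    exact h
  · refine Set.Subset.antisymm (fun x hx => ?_)
      (Set.iUnion_subset fun j => coneGen_mono (Finset.coe_subset.2 (hsub j)))
    obtain ⟨t, ht, hxt⟩ := hcover x (hrange ▸ hx)
    obtain ⟨j, hj⟩ := hsurj t ht
    exact Set.mem_iUnion.2 ⟨j, by rwa [hj, Finset.coe_image]⟩
  · refine Set.Subset.antisymm ?_ (Set.subset_inter (coneGen_mono ?_) (coneGen_mono ?_))
    · have h := hinter _ (𝒯.equivFin.symm i).2 _ (𝒯.equivFin.symm j).2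
      rwa [← hT, ← hT, ← Finset.coe_image, Finset.image_inter _ _ hv] at h
    · exact Finset.coe_subset.2 Finset.inter_subset_left
    · exact Finset.coe_subset.2 Finset.inter_subset_right
  · obtain ⟨i, rfl⟩ : s ∈ Set.range v := hrange ▸ hs
    obtain ⟨t, ht, j, hj, c, hc, h⟩ := hrays i hs0
    obtain ⟨l, hl⟩ := hsurj t ht
    exact ⟨l, v j, hl ▸ Finset.mem_image_of_mem v hj, c, hc, h⟩
end

section
/- Let C ⊆ ℝ^N be a closed convex cone and let G ⊆ C be a subset such that C is the topological closure of cone(G). Let u ∈ C and let F be a finite subset of C consisting of vectors with rational coordinates. Suppose that every g ∈ G can be written as g = a•u + y with a ≥ 0 and y ∈ cone(F). Then C = cone(F ∪ {u}); in particular, if u has rational coordinates, then C is rational polyhedral. -/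
open Pointwise

/-- A vector of `ℝ^N` has rational coordinates. -/
def IsRatVec {N : ℕ} (x : Fin N → ℝ) : Prop := ∀ j, ∃ a : ℚ, x j = (a : ℝ)

namespace PointedCone

lemma mem_hull_finset {E : Type*} [AddCommGroup E] [Module ℝ E] {t : Finset E} {x : E} :
    x ∈ hull ℝ (t : Set E) ↔ ∃ c : E → ℝ, (∀ y ∈ t, 0 ≤ c y) ∧ ∑ y ∈ t, c y • y = x := by
  constructor
  · intro hx
    obtain ⟨c, -, hc⟩ := Submodule.mem_span_finset.1 hx
    exact ⟨fun y => (c y : ℝ), fun y _ => (c y).2, hc⟩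
  · rintro ⟨c, hc, rfl⟩
    exact Submodule.sum_mem _ fun y hy => smul_mem _ (hc y hy) (subset_hull hy)

/-- A conic combination of linearly dependent vectors can be rewritten without one of them. -/
lemma exists_mem_hull_erase {E : Type*} [AddCommGroup E] [Module ℝ E] [DecidableEq E]
    {t : Finset E} (ht : ¬ LinearIndependent ℝ ((↑) : t → E)) {x : E}
    (hx : x ∈ hull ℝ (t : Set E)) : ∃ y ∈ t, x ∈ hull ℝ (t.erase y : Set E) := by
  obtain ⟨c, hc, rfl⟩ := mem_hull_finset.1 hx
  obtain ⟨g, hg, y₀, hy₀, hpos⟩ : ∃ g : E → ℝ, ∑ y ∈ t, g y • y = 0 ∧ ∃ y ∈ t, 0 < g y := by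
    have h : ∃ g : E → ℝ, ∑ y ∈ t, g y • y = 0 ∧ ∃ y ∈ t, g y ≠ 0 := by
      by_contra! h
      exact ht (linearIndepOn_finset_iff.2 h)
    obtain ⟨g, hg, y, hy, hne⟩ := h
    rcases hne.lt_or_gt with hneg | hpos
    · exact ⟨-g, by simp [hg], y, hy, by simpa using hneg⟩
    · exact ⟨g, hg, y, hy, hpos⟩
  obtain ⟨m, hm, hmin⟩ := (t.filter fun y => 0 < g y).exists_min_image (fun y => c y / g y)
    ⟨y₀, Finset.mem_filter.2 ⟨hy₀, hpos⟩⟩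
  obtain ⟨hmt, hgm⟩ := Finset.mem_filter.1 hm
  refine ⟨m, hmt, mem_hull_finset.2 ⟨fun y => c y - c m / g m * g y, fun y hy => ?_, ?_⟩⟩
  · have hyt := Finset.mem_of_mem_erase hy
    rcases le_or_gt (g y) 0 with h | h
    · have := mul_nonpos_of_nonneg_of_nonpos (div_nonneg (hc m hmt) hgm.le) h
      linarith [hc y hyt]
    · have := hmin y (Finset.mem_filter.2 ⟨hyt, h⟩)
      rw [le_div_iff₀ h] at this
      linarith
  · have hm0 : (c m - c m / g m * g m) • m = 0 := by
      rw [div_mul_cancel₀ _ hgm.ne', sub_self, zero_smul]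
    rw [Finset.sum_erase (f := fun y => (c y - c m / g m * g y) • y) t hm0]
    simp only [sub_smul, mul_smul, Finset.sum_sub_distrib, ← Finset.smul_sum, hg, smul_zero,
      sub_zero]

theorem isClosed_hull_finset {E : Type*} [AddCommGroup E] [Module ℝ E] [TopologicalSpace E]
    [IsTopologicalAddGroup E] [ContinuousSMul ℝ E] [T2Space E] (t : Finset E) :
    IsClosed (hull ℝ (t : Set E) : Set E) := by
  classical
  induction t using Finset.strongInduction with
  | H t ih =>
    by_cases ht : LinearIndependent ℝ ((↑) : t → E)
    · have hemb := LinearMap.isClosedEmbedding_of_injective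
        (f := Fintype.linearCombination ℝ ((↑) : t → E))
        (LinearMap.ker_eq_bot.2 ht.fintypeLinearCombination_injective)
      convert hemb.isClosedMap _ (isClosed_Ici (a := (0 : t → ℝ))) using 1
      ext x
      simp only [SetLike.mem_coe, Set.mem_image, Set.mem_Ici, Fintype.linearCombination_apply]
      constructor
      · intro hx
        obtain ⟨c, hc, rfl⟩ := mem_hull_finset.1 hx
        exact ⟨fun y => c y, fun y => hc y y.2, Finset.sum_coe_sort t fun y => c y • y⟩
      · rintro ⟨c, hc, rfl⟩
        exact Submodule.sum_mem _ fun y _ => smul_mem _ (hc y) (subset_hull y.2)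
    · have h : (hull ℝ (t : Set E) : Set E) = ⋃ y ∈ t, (hull ℝ (t.erase y : Set E) : Set E) := by
        ext x
        simp only [Set.mem_iUnion, SetLike.mem_coe, exists_prop]
        exact ⟨exists_mem_hull_erase ht, fun ⟨y, _, hx⟩ =>
          Submodule.span_mono (Finset.coe_subset.2 (t.erase_subset y)) hx⟩
      rw [h]
      exact t.finite_toSet.isClosed_biUnion fun y hy => ih _ (Finset.erase_ssubset hy)

end PointedCone

lemma coneGen_eq_hull {E : Type*} [AddCommGroup E] [Module ℝ E] (Q : Set E) :
    coneGen Q = (PointedCone.hull ℝ Q : Set E) := by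
  ext x
  constructor
  · rintro ⟨k, c, g, hc, hg, rfl⟩
    exact Submodule.sum_mem _ fun i _ =>
      PointedCone.smul_mem _ (hc i) (PointedCone.subset_hull (hg i))
  · intro hx
    obtain ⟨k, c, g, rfl⟩ := Submodule.mem_span_set'.1 hx
    exact ⟨k, fun i => c i, fun i => g i, fun i => (c i).2, fun i => (g i).2, rfl⟩

/-- Let `C ⊆ ℝ^N` be a closed convex cone and `G ⊆ C` a subset with
`C = closure (cone G)`.  Let `u ∈ C` and let `F ⊆ C` be a finite set of rational
vectors.  If every `g ∈ G` can be written as `g = a • u + y` with `a ≥ 0` and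
`y ∈ cone F`, then `C = cone (F ∪ {u})`; in particular, if `u` is rational then
`C` is rational polyhedral. -/
theorem stmt_6 (N : ℕ) (C : Set (Fin N → ℝ))
    (hclosed : IsClosed C) (hconv : Convex ℝ C)
    (hcone : ∀ t : ℝ, 0 ≤ t → ∀ x ∈ C, t • x ∈ C)
    (G : Set (Fin N → ℝ)) (hGC : G ⊆ C)
    (hCG : C = closure (coneGen G))
    (u : Fin N → ℝ) (hu : u ∈ C)
    (F : Finset (Fin N → ℝ)) (hFC : (F : Set (Fin N → ℝ)) ⊆ C)
    (hFrat : ∀ x ∈ F, IsRatVec x)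
    (hsplit : ∀ g ∈ G, ∃ a : ℝ, 0 ≤ a ∧
        ∃ y ∈ coneGen (F : Set (Fin N → ℝ)), g = a • u + y) :
    C = coneGen ((F : Set (Fin N → ℝ)) ∪ {u}) := by
  have hFu : ((F : Set (Fin N → ℝ)) ∪ {u}) = (insert u F : Finset (Fin N → ℝ)) := by
    rw [Finset.coe_insert, Set.union_singleton]
  have huF : u ∈ PointedCone.hull ℝ ((F : Set (Fin N → ℝ)) ∪ {u}) :=
    PointedCone.subset_hull (Or.inr rfl)
  apply Set.Subset.antisymm
  · rw [hCG, coneGen_eq_hull, coneGen_eq_hull]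
    refine closure_minimal (SetLike.coe_subset_coe.2 (Submodule.span_le.2 fun g hg => ?_)) ?_
    · obtain ⟨a, ha, y, hy, rfl⟩ := hsplit g hg
      rw [coneGen_eq_hull] at hy
      exact add_mem (PointedCone.smul_mem _ ha huF)
        (Submodule.span_mono Set.subset_union_left hy)
    · rw [hFu]
      exact PointedCone.isClosed_hull_finset _
  · have hadd : ∀ x ∈ C, ∀ y ∈ C, x + y ∈ C := fun x hx y hy => by
      have h := hcone 2 zero_le_two _ (hconv hx hy (a := 1 / 2) (b := 1 / 2) (by norm_num)
        (by norm_num) (by norm_num))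
      simpa [smul_smul] using h
    have hzero : (0 : Fin N → ℝ) ∈ C := by simpa using hcone 0 le_rfl u hu
    rintro x ⟨k, c, g, hc, hg, rfl⟩
    refine Finset.sum_induction _ (· ∈ C) (fun x y hx hy => hadd x hx y hy) hzero
      fun i _ => hcone _ (hc i) _ ?_
    rcases hg i with h | h
    · exact hFC h
    · exact h ▸ hu
end
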